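/- Let φ = (1 + √5)/2. There exists a deterministic online algorithm for cardinality constrained scheduling on m = 2 machines with cardinality bound k = 2 that is φ-competitive: on every input sequence of at most 4 jobs, the induced schedule is feasible and its makespan is at most φ·OPT. -/

import Mathlib

open Finset

/-- The load of machine `i` under schedule `σ` for job sizes `p`. -/
noncomputable def machineLoad {n m : ℕ} (p : Fin n → ℝ) (σ : Fin n → Fin m) (i : Fin m) : ℝ :=
  ∑ j ∈ Finset.univ.filter (fun j => σ j = i), p j

/-- The makespan of a schedule: the maximum machine load. -/
noncomputable def makespan {n m : ℕ} (p : Fin n → ℝ) (σ : Fin n → Fin m) : ℝ :=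
  sSup (Set.range (machineLoad p σ))

/-- A schedule is feasible for cardinality bound `k` if every machine gets at most `k` jobs. -/
def Feasible {n m : ℕ} (k : ℕ) (σ : Fin n → Fin m) : Prop :=
  ∀ i : Fin m, (Finset.univ.filter (fun j => σ j = i)).card ≤ k

/-- The optimal (minimum) makespan over all feasible schedules on `m` machines with
cardinality bound `k`. -/
noncomputable def OPT (m k : ℕ) {n : ℕ} (p : Fin n → ℝ) : ℝ :=
  sInf ((fun σ : Fin n → Fin m => makespan p σ) '' {σ | Feasible k σ})

/-- The schedule induced by a deterministic online algorithm `A` on input sequence `p`: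
job `j` is assigned to the machine `A (p 1, …, p j)`. -/
def onlineSchedule {m : ℕ} (A : List ℝ → Fin m) {n : ℕ} (p : Fin n → ℝ) : Fin n → Fin m :=
  fun j => A ((List.ofFn p).take (j.1 + 1))

/-- An online algorithm is `α`-competitive if on every input sequence of at most `m*k`
nonnegative jobs the induced schedule is feasible and its makespan is at most `α * OPT`. -/
def Competitive (m k : ℕ) (A : List ℝ → Fin m) (α : ℝ) : Prop :=
  ∀ n : ℕ, n ≤ m * k → ∀ p : Fin n → ℝ, (∀ j, 0 ≤ p j) →
    Feasible k (onlineSchedule A p) ∧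
      makespan p (onlineSchedule A p) ≤ α * OPT m k p

open Classical in
/-- The machine of the third job, when the first two jobs `a` and `b` are on machines `0` and `1`:
the third job `c` joins the larger job `y` of these two if `y + c ≤ φ * y`. -/
noncomputable def thirdMachine (a b c : ℝ) : Fin 2 :=
  if a ≤ b then (if b + c ≤ Real.goldenRatio * b then 1 else 0)
  else (if a + c ≤ Real.goldenRatio * a then 0 else 1)

/-- The golden ratio algorithm: the first two jobs are separated, and the last two jobs are
separated, the machine of the third one being decided by `thirdMachine`. -/
noncomputable def goldenAlgorithm : List ℝ → Fin 2
  | [_, _] => 1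
  | [a, b, c] => thirdMachine a b c
  | [a, b, c, _] => 1 - thirdMachine a b c
  | _ => 0

theorem machineLoad_le_makespan {n m : ℕ} (p : Fin n → ℝ) (σ : Fin n → Fin m) (i : Fin m) :
    machineLoad p σ i ≤ makespan p σ :=
  le_csSup (Set.finite_range _).bddAbove (Set.mem_range_self i)

theorem makespan_le_mul_OPT {n m k : ℕ} [NeZero m] {p : Fin n → ℝ} {τ : Fin n → Fin m} {α : ℝ}
    (hα : 0 < α) (hτ : Feasible k τ)
    (h : ∀ σ : Fin n → Fin m, Feasible k σ → ∀ i, machineLoad p τ i ≤ α * makespan p σ) :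
    makespan p τ ≤ α * OPT m k p := by
  rw [← div_le_iff₀' hα]
  refine le_csInf ⟨_, τ, hτ, rfl⟩ ?_
  rintro _ ⟨σ, hσ, rfl⟩
  rw [div_le_iff₀' hα]
  exact csSup_le (Set.range_nonempty _) (Set.forall_mem_range.2 (h σ hσ))

/-- `M` bounds the makespan of some partition of four jobs into two pairs. -/
def PairingBound (a b c d M : ℝ) : Prop :=
  (a + b ≤ M ∧ c + d ≤ M) ∨ (a + c ≤ M ∧ b + d ≤ M) ∨ (a + d ≤ M ∧ b + c ≤ M)

theorem PairingBound.swap {a b c d M : ℝ} (h : PairingBound a b c d M) :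
    PairingBound b a c d M := by
  unfold PairingBound at *
  grind

theorem three_halves_le_goldenRatio : 3 / 2 ≤ Real.goldenRatio := by
  nlinarith [Real.goldenRatio_sq, Real.one_lt_goldenRatio]

theorem le_goldenRatio_mul {x M : ℝ} (hM : 0 ≤ M) (h : x ≤ 3 / 2 * M) :
    x ≤ Real.goldenRatio * M :=
  h.trans (mul_le_mul_of_nonneg_right three_halves_le_goldenRatio hM)

theorem PairingBound.of_joins_larger {x y c d M : ℝ} (hx : 0 ≤ x) (hxy : x ≤ y) (hc : 0 ≤ c)
    (hd : 0 ≤ d) (hM : PairingBound x y c d M) (h : y + c ≤ Real.goldenRatio * y) :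
    y + c ≤ Real.goldenRatio * M ∧ x + d ≤ Real.goldenRatio * M := by
  have hyM : y ≤ M := by rcases hM with hM | hM | hM <;> linarith
  refine ⟨h.trans (mul_le_mul_of_nonneg_left hyM Real.goldenRatio_pos.le),
    le_goldenRatio_mul (by linarith) ?_⟩
  rcases hM with hM | hM | hM <;> linarith

theorem PairingBound.of_joins_smaller {x y c d M : ℝ} (hx : 0 ≤ x) (hxy : x ≤ y) (hc : 0 ≤ c)
    (hd : 0 ≤ d) (hM : PairingBound x y c d M) (h : ¬ y + c ≤ Real.goldenRatio * y) :
    x + c ≤ Real.goldenRatio * M ∧ y + d ≤ Real.goldenRatio * M := by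
  have hM0 : 0 ≤ M := by rcases hM with hM | hM | hM <;> linarith
  have hφ := Real.goldenRatio_sq
  have hφ₁ := Real.one_lt_goldenRatio
  constructor
  · refine le_goldenRatio_mul hM0 ?_
    rcases hM with hM | hM | hM <;> linarith
  · rcases hM with ⟨-, hM⟩ | ⟨-, hM⟩ | ⟨hM, hM'⟩
    · have := mul_le_mul_of_nonneg_left hM Real.goldenRatio_pos.le
      have := mul_le_mul_of_nonneg_left (not_le.1 h).le Real.goldenRatio_pos.le
      nlinarith
    · exact le_goldenRatio_mul hM0 (by linarith)
    · have : Real.goldenRatio * y ≤ M := by linarith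
      nlinarith [mul_le_mul_of_nonneg_left this (sub_nonneg.2 hφ₁.le)]

theorem PairingBound.thirdMachine {a b c d M : ℝ} (ha : 0 ≤ a) (hb : 0 ≤ b) (hc : 0 ≤ c)
    (hd : 0 ≤ d) (hM : PairingBound a b c d M) :
    (thirdMachine a b c = 0 ∧ a + c ≤ Real.goldenRatio * M ∧ b + d ≤ Real.goldenRatio * M) ∨
      (thirdMachine a b c = 1 ∧ b + c ≤ Real.goldenRatio * M ∧ a + d ≤ Real.goldenRatio * M) := by
  unfold _root_.thirdMachine
  split_ifs with hab h h
  · exact .inr ⟨rfl, hM.of_joins_larger ha hab hc hd h⟩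
  · exact .inl ⟨rfl, hM.of_joins_smaller ha hab hc hd h⟩
  · exact .inl ⟨rfl, hM.swap.of_joins_larger hb (le_of_not_ge hab) hc hd h⟩
  · exact .inr ⟨rfl, hM.swap.of_joins_smaller hb (le_of_not_ge hab) hc hd h⟩

theorem pairingBound_makespan_three {p : Fin 3 → ℝ} {σ : Fin 3 → Fin 2} (hσ : Feasible 2 σ) :
    PairingBound (p 0) (p 1) (p 2) 0 (makespan p σ) := by
  have h0 := machineLoad_le_makespan p σ 0
  have h1 := machineLoad_le_makespan p σ 1
  have hc0 := hσ 0
  have hc1 := hσ 1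
  simp only [machineLoad, Finset.sum_filter, Finset.card_filter, Fin.sum_univ_succ] at h0 h1 hc0 hc1
  unfold PairingBound
  rcases Fin.exists_fin_two.1 ⟨σ 0, rfl⟩ with e0 | e0 <;>
  rcases Fin.exists_fin_two.1 ⟨σ 1, rfl⟩ with e1 | e1 <;>
  rcases Fin.exists_fin_two.1 ⟨σ 2, rfl⟩ with e2 | e2 <;>
  simp_all

theorem pairingBound_makespan_four {p : Fin 4 → ℝ} {σ : Fin 4 → Fin 2} (hσ : Feasible 2 σ) :
    PairingBound (p 0) (p 1) (p 2) (p 3) (makespan p σ) := by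
  have h0 := machineLoad_le_makespan p σ 0
  have h1 := machineLoad_le_makespan p σ 1
  have hc0 := hσ 0
  have hc1 := hσ 1
  simp only [machineLoad, Finset.sum_filter, Finset.card_filter, Fin.sum_univ_succ] at h0 h1 hc0 hc1
  unfold PairingBound
  rcases Fin.exists_fin_two.1 ⟨σ 0, rfl⟩ with e0 | e0 <;>
  rcases Fin.exists_fin_two.1 ⟨σ 1, rfl⟩ with e1 | e1 <;>
  rcases Fin.exists_fin_two.1 ⟨σ 2, rfl⟩ with e2 | e2 <;>
  rcases Fin.exists_fin_two.1 ⟨σ 3, rfl⟩ with e3 | e3 <;>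
  simp_all

theorem makespan_nonneg {n m : ℕ} {p : Fin n → ℝ} (hp : ∀ j, 0 ≤ p j) (σ : Fin n → Fin m) :
    0 ≤ makespan p σ := by
  refine Real.sSup_nonneg ?_
  rintro _ ⟨i, rfl⟩
  exact Finset.sum_nonneg fun j _ => hp j

theorem le_makespan {n m : ℕ} {p : Fin n → ℝ} (hp : ∀ j, 0 ≤ p j) (σ : Fin n → Fin m)
    (j : Fin n) : p j ≤ makespan p σ :=
  (Finset.single_le_sum (fun i _ => hp i) (by simp)).trans (machineLoad_le_makespan p σ (σ j))

/-- Let `φ = (1 + √5)/2`.  There is a deterministic online algorithm for cardinality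
constrained scheduling on `m = 2` machines with cardinality bound `k = 2` that is
`φ`-competitive. -/
theorem exists_golden_ratio_competitive_algorithm_m2_k2 :
    ∃ A : List ℝ → Fin 2, Competitive 2 2 A ((1 + Real.sqrt 5) / 2) := by
  refine ⟨goldenAlgorithm, fun n hn p hp => ?_⟩
  change _ ∧ _ ≤ Real.goldenRatio * _
  suffices h : Feasible 2 (onlineSchedule goldenAlgorithm p) ∧
      ∀ σ : Fin n → Fin 2, Feasible 2 σ → ∀ i,
        machineLoad p (onlineSchedule goldenAlgorithm p) i ≤ Real.goldenRatio * makespan p σ from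
    ⟨h.1, makespan_le_mul_OPT Real.goldenRatio_pos h.1 h.2⟩
  have hle (σ : Fin n → Fin 2) (j : Fin n) : p j ≤ Real.goldenRatio * makespan p σ :=
    le_goldenRatio_mul (makespan_nonneg hp σ)
      (by linarith [le_makespan hp σ j, makespan_nonneg hp σ])
  have hnn (σ : Fin n → Fin 2) : 0 ≤ Real.goldenRatio * makespan p σ :=
    mul_nonneg Real.goldenRatio_pos.le (makespan_nonneg hp σ)
  interval_cases n
  · simp [Feasible, machineLoad, hnn]
  · have e : onlineSchedule goldenAlgorithm p = ![0] := by
      ext j; fin_cases j; simp [onlineSchedule, goldenAlgorithm]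
    rw [e]
    refine ⟨by unfold Feasible; decide, fun σ _ i => ?_⟩
    fin_cases i <;> simp [machineLoad, hle, hnn]
  · have e : onlineSchedule goldenAlgorithm p = ![0, 1] := by
      ext j; fin_cases j <;> simp [onlineSchedule, goldenAlgorithm]
    rw [e]
    refine ⟨by unfold Feasible; decide, fun σ _ i => ?_⟩
    fin_cases i <;> simp [machineLoad, Finset.sum_filter, Fin.sum_univ_succ, hle]
  · have e : onlineSchedule goldenAlgorithm p = ![0, 1, thirdMachine (p 0) (p 1) (p 2)] := by
      ext j; fin_cases j <;> simp [onlineSchedule, goldenAlgorithm]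
    rw [e]
    constructor
    · generalize thirdMachine _ _ _ = t
      unfold Feasible
      decide +revert
    · intro σ hσ i
      rcases (pairingBound_makespan_three hσ).thirdMachine (hp 0) (hp 1) (hp 2) le_rfl with
        ⟨ht, h0, h1⟩ | ⟨ht, h0, h1⟩ <;> rw [ht] <;> fin_cases i <;>
        simp_all [machineLoad, Finset.sum_filter, Fin.sum_univ_succ]
  · have e : onlineSchedule goldenAlgorithm p =
        ![0, 1, thirdMachine (p 0) (p 1) (p 2), 1 - thirdMachine (p 0) (p 1) (p 2)] := by
      ext j; fin_cases j <;> simp [onlineSchedule, goldenAlgorithm]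
    rw [e]
    constructor
    · generalize thirdMachine _ _ _ = t
      unfold Feasible
      decide +revert
    · intro σ hσ i
      rcases (pairingBound_makespan_four hσ).thirdMachine (hp 0) (hp 1) (hp 2) (hp 3) with
        ⟨ht, h0, h1⟩ | ⟨ht, h0, h1⟩ <;> rw [ht] <;> fin_cases i <;>
        simp_all [machineLoad, Finset.sum_filter, Fin.sum_univ_succ]
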